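/- Let E be a finite acyclic directed graph with N ≥ 2 edges, let 1 ≤ k ≤ N, and write N = n·k + r with 0 ≤ r ≤ k − 1. Then the number of paths of length k in E is at most P^N_k := (n+1)^r · n^(k−r). -/

import Mathlib

/-- A directed graph: a set of vertices, a set of edges, and source/target maps
(parallel edges are allowed). -/
structure DiGraph where
  V : Type
  E : Type
  s : E → V
  t : E → V

namespace DiGraph

/-- `p = (e₁, …, e_k)` is a path of length `k`: `t eᵢ = s eᵢ₊₁` for `1 ≤ i < k`. -/
def IsPath (G : DiGraph) {k : ℕ} (p : Fin k → G.E) : Prop :=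
  ∀ (i : ℕ) (hi : i + 1 < k), G.t (p ⟨i, by omega⟩) = G.s (p ⟨i + 1, hi⟩)

/-- A loop is a (nonempty) path whose source equals its target. -/
def IsLoop (G : DiGraph) {k : ℕ} (p : Fin k → G.E) : Prop :=
  G.IsPath p ∧ ∃ hk : 0 < k, G.s (p ⟨0, hk⟩) = G.t (p ⟨k - 1, by omega⟩)

/-- A directed graph is acyclic if it contains no loops. -/
def Acyclic (G : DiGraph) : Prop :=
  ∀ (m : ℕ) (q : Fin m → G.E), ¬ G.IsLoop q

end DiGraph


open Classical in
/-- Each factor is bounded by a geometric weight. -/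
lemma bal_aux (n a : ℕ) (hn : 1 ≤ n) :
    (a : ℝ) / n ≤ (1 + 1 / (n : ℝ)) ^ ((a : ℤ) - n) := by
  have hn' : (0 : ℝ) < n := by exact_mod_cast hn
  have hb : (1 + 1 / (n : ℝ)) = (n + 1) / n := by field_simp
  have hb0 : (0 : ℝ) < (n + 1) / n := by positivity
  rw [hb]
  rcases le_total n a with h | h
  · obtain ⟨d, rfl⟩ := Nat.exists_eq_add_of_le h
    have : ((n + d : ℕ) : ℤ) - n = (d : ℤ) := by push_cast; ring
    rw [this, zpow_natCast]
    have := one_add_mul_le_pow (a := (1 : ℝ) / n)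
      (by have : (0 : ℝ) ≤ 1 / n := by positivity
          linarith) d
    rw [hb] at this
    refine le_trans (le_of_eq ?_) this
    push_cast
    field_simp
  · obtain ⟨d, rfl⟩ := Nat.exists_eq_add_of_le h
    have : ((a : ℕ) : ℤ) - (a + d : ℕ) = -(d : ℤ) := by push_cast; ring
    rw [this, zpow_neg, zpow_natCast, ← inv_pow, inv_div]
    have h2 := one_add_mul_le_pow (a := -(1 : ℝ) / ((a + d : ℕ) + 1))
      (by
        rw [le_div_iff₀ (by positivity)]
        linarith) d
    have e1 : (1 + -(1 : ℝ) / ((a + d : ℕ) + 1)) = ((a + d : ℕ) : ℝ) / ((a + d : ℕ) + 1) := by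
      field_simp
      ring
    rw [e1] at h2
    refine le_trans ?_ h2
    have e2 : (a : ℝ) / (a + d : ℕ) = 1 - d / (a + d : ℕ) := by
      field_simp
      push_cast
      ring
    have e3 : (d : ℝ) / ((a + d : ℕ) + 1) ≤ d / (a + d : ℕ) := by
      gcongr
      linarith
    rw [e2]
    have : (d : ℝ) * (-1 / ((a + d : ℕ) + 1)) = - (d / ((a + d : ℕ) + 1)) := by ring
    rw [this]
    linarith

lemma bal_prod (k n r : ℕ) (hn : 1 ≤ n) (hr : r ≤ k) (a : Fin k → ℕ)
    (hs : ∑ i, a i = n * k + r) : ∏ i, a i ≤ (n + 1) ^ r * n ^ (k - r) := by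
  have hn' : (0 : ℝ) < n := by exact_mod_cast hn
  have h1 : ∏ i, ((a i : ℝ) / n) ≤ ∏ i, (1 + 1 / (n : ℝ)) ^ ((a i : ℤ) - n) :=
    Finset.prod_le_prod (fun i _ => by positivity) (fun i _ => bal_aux n (a i) hn)
  have h2 : ∏ i, (1 + 1 / (n : ℝ)) ^ ((a i : ℤ) - n) = (1 + 1 / (n : ℝ)) ^ r := by
    have hz : ∀ s : Finset (Fin k), ∏ i ∈ s, (1 + 1 / (n : ℝ)) ^ ((a i : ℤ) - n)
        = (1 + 1 / (n : ℝ)) ^ (∑ i ∈ s, ((a i : ℤ) - n)) := by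
      intro s
      induction s using Finset.cons_induction with
      | empty => simp
      | cons b s hb ih =>
        rw [Finset.prod_cons, Finset.sum_cons, ih, zpow_add₀ (by positivity)]
    rw [hz]
    have : ∑ i, ((a i : ℤ) - n) = (r : ℤ) := by
      rw [Finset.sum_sub_distrib, ← Nat.cast_sum, hs]
      simp
      ring
    rw [this, zpow_natCast]
  rw [h2, Finset.prod_div_distrib] at h1
  simp only [Finset.prod_const, Finset.card_univ, Fintype.card_fin] at h1
  rw [div_le_iff₀ (by positivity)] at h1
  have h3 : (1 + 1 / (n : ℝ)) ^ r * (n : ℝ) ^ k = (n + 1) ^ r * n ^ (k - r) := by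
    have : (n : ℝ) ^ k = n ^ r * n ^ (k - r) := by rw [← pow_add]; congr 1; omega
    rw [this, ← mul_assoc, ← mul_pow]
    congr 2
    field_simp
  rw [h3] at h1
  exact_mod_cast h1

namespace DiGraph

/-- One-step reachability. -/
def Step (G : DiGraph) (u v : G.V) : Prop := ∃ e, G.s e = u ∧ G.t e = v

lemma exists_path_of_transGen (G : DiGraph) {u v : G.V} (h : Relation.TransGen G.Step u v) :
    ∃ (m : ℕ) (q : Fin (m + 1) → G.E), G.IsPath q ∧ G.s (q 0) = u ∧ G.t (q (Fin.last m)) = v := by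
  induction h with
  | single h =>
    obtain ⟨e, h1, h2⟩ := h
    refine ⟨0, fun _ => e, ?_, h1, h2⟩
    intro i hi
    omega
  | tail _ h ih =>
    obtain ⟨m, q, hq, h1, h2⟩ := ih
    obtain ⟨e, h3, h4⟩ := h
    refine ⟨m + 1, Fin.snoc (α := fun _ => G.E) q e, ?_, ?_, ?_⟩
    · intro i hi
      by_cases him : i + 1 < m + 1
      · have := hq i him
        simpa [Fin.snoc, him, show i < m + 1 by omega] using this
      · have : i = m := by omega
        subst this
        simp only [Fin.snoc, lt_irrefl, dif_neg, not_false_eq_true, Nat.lt_succ_self, dif_pos]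
        simp only [cast_eq]
        rw [h3, ← h2]
        rfl
    · simpa [Fin.snoc] using h1
    · simpa using h4

lemma exists_height (G : DiGraph) [Finite G.V] (hac : G.Acyclic) :
    ∃ h : G.V → ℕ, ∀ e, h (G.s e) < h (G.t e) := by
  refine ⟨fun v => Set.ncard {u | Relation.TransGen G.Step u v}, fun e => ?_⟩
  apply Set.ncard_lt_ncard _ (Set.toFinite _)
  have he : Relation.TransGen G.Step (G.s e) (G.t e) := .single ⟨e, rfl, rfl⟩
  refine ⟨fun u hu => Relation.TransGen.trans hu he, fun hsub => ?_⟩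
  have : Relation.TransGen G.Step (G.s e) (G.s e) := hsub he
  obtain ⟨m, q, hq, h1, h2⟩ := G.exists_path_of_transGen this
  refine hac (m + 1) q ⟨hq, Nat.succ_pos _, ?_⟩
  exact h1.trans h2.symm

lemma path_height (G : DiGraph) (h : G.V → ℕ) (hh : ∀ e, h (G.s e) < h (G.t e))
    {k : ℕ} {p : Fin k → G.E} (hp : G.IsPath p) {i j : Fin k} (hij : i < j) :
    h (G.t (p i)) ≤ h (G.s (p j)) := by
  obtain ⟨i, hi⟩ := i
  obtain ⟨j, hj⟩ := j
  have hij' : i + 1 ≤ j := hij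
  clear hij
  induction j, hij' using Nat.le_induction with
  | base => exact le_of_eq (congrArg h (hp i hj))
  | succ j hj' ih =>
    have h1 := ih (by omega)
    have h2 := hp j hj
    have h3 := hh (p ⟨j, by omega⟩)
    rw [h2] at h3
    omega

lemma path_strictMono (G : DiGraph) (h : G.V → ℕ) (hh : ∀ e, h (G.s e) < h (G.t e))
    {k : ℕ} {p : Fin k → G.E} (hp : G.IsPath p) : StrictMono (fun i => h (G.s (p i))) :=
  fun i j hij => lt_of_lt_of_le (hh (p i)) (G.path_height h hh hp hij)

lemma path_injective (G : DiGraph) (h : G.V → ℕ) (hh : ∀ e, h (G.s e) < h (G.t e))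
    {k : ℕ} {p : Fin k → G.E} (hp : G.IsPath p) : Function.Injective p := by
  intro i j hij
  exact (G.path_strictMono h hh hp).injective (by simp [hij])

/-- Intervals of a path cover. -/
lemma path_cover (G : DiGraph) (h : G.V → ℕ)
    {k : ℕ} {p : Fin k → G.E} (hp : G.IsPath p) (x : ℕ) (j : ℕ) (hj : j < k)
    (h0 : h (G.s (p ⟨0, by omega⟩)) ≤ x) (h1 : x < h (G.t (p ⟨j, hj⟩))) :
    ∃ i, h (G.s (p i)) ≤ x ∧ x < h (G.t (p i)) := by
  induction j with
  | zero => exact ⟨_, h0, h1⟩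
  | succ j ih =>
    by_cases hx : x < h (G.t (p ⟨j, by omega⟩))
    · exact ih (by omega) h0 hx
    · refine ⟨⟨j + 1, hj⟩, ?_, h1⟩
      rw [← hp j hj]
      omega

open Classical in
/-- Weighted number of paths. -/
noncomputable def wcount (G : DiGraph) [Fintype G.E] (k : ℕ) (w : G.E → ℕ) : ℕ :=
  ∑ p : Fin k → G.E with G.IsPath p, ∏ i, w (p i)

open Classical in
/-- Move the weight of `f` onto `e`. -/
noncomputable def shift (G : DiGraph) (w : G.E → ℕ) (e f : G.E) : G.E → ℕ :=
  fun x => if x = f then 0 else if x = e then w e + w f else w x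

lemma shift_prod_neither (G : DiGraph) (w : G.E → ℕ) (e f : G.E) {k : ℕ} (p : Fin k → G.E)
    (he : ∀ i, p i ≠ e) (hf : ∀ i, p i ≠ f) : ∏ i, G.shift w e f (p i) = ∏ i, w (p i) := by
  apply Finset.prod_congr rfl
  intro i _
  simp [shift, he i, hf i]

lemma shift_prod_left (G : DiGraph) (w : G.E → ℕ) (e f : G.E) {k : ℕ} (p : Fin k → G.E)
    (hinj : Function.Injective p) (i : Fin k) (he : p i = e) (hf : ∀ i, p i ≠ f) :
    w e * ∏ i, G.shift w e f (p i) = (w e + w f) * ∏ i, w (p i) := by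
  have h1 : ∏ j, G.shift w e f (p j) = (w e + w f) * ∏ j ∈ Finset.univ.erase i, w (p j) := by
    rw [← Finset.mul_prod_erase _ _ (Finset.mem_univ i)]
    congr 1
    · have := hf i
      simp_all [shift]
    · apply Finset.prod_congr rfl
      intro j hj
      have : p j ≠ e := by
        rintro h
        exact (Finset.ne_of_mem_erase hj) (hinj (h.trans he.symm))
      simp [shift, hf j, this]
  have h2 : ∏ j, w (p j) = w e * ∏ j ∈ Finset.univ.erase i, w (p j) := by
    rw [← Finset.mul_prod_erase _ _ (Finset.mem_univ i), he]
  rw [h1, h2]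
  ring

lemma shift_le (G : DiGraph) [Fintype G.E] (h : G.V → ℕ) (hh : ∀ e, h (G.s e) < h (G.t e))
    (k : ℕ) (w : G.E → ℕ) (e f : G.E)
    (hno : ∀ p : Fin k → G.E, G.IsPath p → (∀ i, 0 < w (p i)) → (∃ i, p i = e) →
      ¬ ∃ i, p i = f) :
    (w e + w f) * G.wcount k w ≤
      w e * G.wcount k (G.shift w e f) + w f * G.wcount k (G.shift w f e) := by
  unfold wcount
  rw [Finset.mul_sum, Finset.mul_sum, Finset.mul_sum, ← Finset.sum_add_distrib]
  apply Finset.sum_le_sum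
  intro p hp
  have hp : G.IsPath p := by simpa using hp
  have hinj := G.path_injective h hh hp
  by_cases he : ∃ i, p i = e
  · by_cases hf : ∃ i, p i = f
    · have : ∏ i, w (p i) = 0 := by
        by_contra h0
        refine hno p hp (fun i => ?_) he hf
        have := Finset.prod_ne_zero_iff.mp h0 i (Finset.mem_univ i)
        omega
      simp [this]
    · push Not at hf
      obtain ⟨i, hi⟩ := he
      rw [G.shift_prod_left w e f p hinj i hi hf]
      omega
  · push Not at he
    by_cases hf : ∃ i, p i = f
    · obtain ⟨i, hi⟩ := hf
      rw [G.shift_prod_left w f e p hinj i hi he, add_comm (w e)]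
      omega
    · push Not at hf
      rw [G.shift_prod_neither w e f p he hf, G.shift_prod_neither w f e p hf he]
      exact le_of_eq (by ring)

lemma shift_sum (G : DiGraph) [Fintype G.E] (w : G.E → ℕ) (e f : G.E) (hef : e ≠ f) :
    ∑ x, G.shift w e f x = ∑ x, w x := by
  classical
  have hm : e ∈ Finset.univ.erase f := by simp [hef]
  rw [← Finset.add_sum_erase _ _ (Finset.mem_univ f), ← Finset.add_sum_erase _ _ hm,
    ← Finset.add_sum_erase _ w (Finset.mem_univ f), ← Finset.add_sum_erase _ w hm]
  have : ∑ x ∈ (Finset.univ.erase f).erase e, G.shift w e f x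
      = ∑ x ∈ (Finset.univ.erase f).erase e, w x := by
    apply Finset.sum_congr rfl
    intro x hx
    simp only [Finset.mem_erase, Finset.mem_univ, and_true] at hx
    simp [shift, hx.1, hx.2]
  rw [this]
  simp [shift, hef]
  ring

open Classical in
lemma shift_supp (G : DiGraph) [Fintype G.E] (w : G.E → ℕ) (e f : G.E)
    (he : 0 < w e) (hf : 0 < w f) :
    (Finset.univ.filter fun x => 0 < G.shift w e f x).card
      < (Finset.univ.filter fun x => 0 < w x).card := by
  apply Finset.card_lt_card
  refine ⟨fun x hx => ?_, fun hsub => ?_⟩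
  · have hx := (Finset.mem_filter.mp hx).2
    refine Finset.mem_filter.mpr ⟨Finset.mem_univ _, ?_⟩
    unfold shift at hx
    split_ifs at hx with h1 h2
    · omega
    · subst h2; exact he
    · exact hx
  · have : f ∈ Finset.univ.filter fun x => 0 < G.shift w e f x := hsub (by simp [hf])
    have := (Finset.mem_filter.mp this).2
    simp [shift] at this

/-- Terminal case: any two support edges lie on a common positive path. -/
lemma wcount_terminal (G : DiGraph) [Fintype G.E] (h : G.V → ℕ)
    (hh : ∀ e, h (G.s e) < h (G.t e)) (k n r : ℕ) (hk : 1 ≤ k) (hn : 1 ≤ n) (hr : r ≤ k)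
    (w : G.E → ℕ) (hw : ∑ x, w x = n * k + r)
    (hall : ∀ e f, e ≠ f → 0 < w e → 0 < w f → ∃ p : Fin k → G.E, G.IsPath p ∧
      (∀ i, 0 < w (p i)) ∧ (∃ i, p i = e) ∧ ∃ i, p i = f) :
    G.wcount k w ≤ (n + 1) ^ r * n ^ (k - r) := by
  classical
  by_cases hpos : ∃ p : Fin k → G.E, G.IsPath p ∧ ∀ i, 0 < w (p i)
  swap
  · have : G.wcount k w = 0 := by
      unfold wcount
      apply Finset.sum_eq_zero
      intro p hp
      by_contra h0
      refine hpos ⟨p, by simpa using hp, fun i => ?_⟩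
      have := Finset.prod_ne_zero_iff.mp h0 i (Finset.mem_univ i)
      omega
    omega
  obtain ⟨p0, hp0, hp0w⟩ := hpos
  -- disjointness
  have hdisj : ∀ e f, e ≠ f → 0 < w e → 0 < w f →
      h (G.t e) ≤ h (G.s f) ∨ h (G.t f) ≤ h (G.s e) := by
    intro e f hef he hf
    obtain ⟨p, hp, -, ⟨i, rfl⟩, ⟨j, rfl⟩⟩ := hall e f hef he hf
    rcases lt_trichotomy i j with hij | hij | hij
    · exact Or.inl (G.path_height h hh hp hij)
    · exact absurd (congrArg p hij) hef
    · exact Or.inr (G.path_height h hh hp hij)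
  set S := Finset.univ.filter fun x => 0 < w x with hS
  have hSmem : ∀ x, x ∈ S ↔ 0 < w x := by intro x; simp [hS]
  have hSne : S.Nonempty := ⟨p0 ⟨0, hk⟩, (hSmem _).2 (hp0w _)⟩
  obtain ⟨a, haS, hamin⟩ := S.exists_min_image (fun x => h (G.s x)) hSne
  obtain ⟨b, hbS, hbmax⟩ := S.exists_max_image (fun x => h (G.t x)) hSne
  have hex : ∃ p : Fin k → G.E, G.IsPath p ∧
      (∀ i, 0 < w (p i)) ∧ (∃ i, p i = a) ∧ ∃ i, p i = b := by
    by_cases hab : a = b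
    · refine ⟨p0, hp0, hp0w, ?_⟩
      have key : p0 ⟨0, hk⟩ = a := by
        by_contra hne
        have h1 := hamin _ ((hSmem _).2 (hp0w ⟨0, hk⟩))
        have h2 := hbmax _ ((hSmem _).2 (hp0w ⟨0, hk⟩))
        have h3 := hh (p0 ⟨0, hk⟩)
        have h4 := hh a
        subst hab
        rcases hdisj _ _ hne (hp0w _) ((hSmem _).1 haS) with h5 | h5 <;> omega
      exact ⟨⟨_, key⟩, ⟨_, key.trans hab⟩⟩
    · exact hall a b hab ((hSmem _).1 haS) ((hSmem _).1 hbS)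
  obtain ⟨p, hp, hpw, ⟨ia, hia⟩, ⟨ib, hib⟩⟩ := hex
  have hpinj := G.path_injective h hh hp
  have hcov : ∀ g, 0 < w g → ∃ i, p i = g := by
    intro g hg
    have h0 : h (G.s (p ⟨0, hk⟩)) ≤ h (G.s g) := by
      have h1 := (G.path_strictMono h hh hp).monotone (show (⟨0, hk⟩ : Fin k) ≤ ia from Nat.zero_le _)
      have h2 := hamin g ((hSmem _).2 hg)
      simp only [hia] at h1 h2
      omega
    have h1 : h (G.s g) < h (G.t (p ⟨ib.1, ib.2⟩)) := by
      have h2 := hbmax g ((hSmem _).2 hg)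
      have h3 := hh g
      simp only [Fin.eta, hib] at h2 ⊢
      omega
    obtain ⟨i, hi1, hi2⟩ := G.path_cover h hp _ _ ib.2 h0 h1
    refine ⟨i, ?_⟩
    by_contra hne
    have := hh g
    rcases hdisj _ _ hne (hpw i) hg with h5 | h5 <;> omega
  have huniq : ∀ q : Fin k → G.E, G.IsPath q → (∀ i, 0 < w (q i)) → q = p := by
    intro q hq hqw
    choose σ hσ using fun i => hcov (q i) (hqw i)
    have hσm : StrictMono σ := by
      intro i j hij
      have := G.path_strictMono h hh hq hij
      simp only [← hσ] at this
      exact (G.path_strictMono h hh hp).lt_iff_lt.mp this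
    have hsurj : Function.Surjective σ := Finite.injective_iff_surjective.mp hσm.injective
    have : σ = id := (StrictMono.range_inj hσm strictMono_id).mp (by simp [hsurj.range_eq])
    funext i
    rw [← hσ, this]
    rfl
  have hcount : G.wcount k w = ∏ i, w (p i) := by
    unfold wcount
    apply Finset.sum_eq_single p
    · intro q hq hne
      by_contra h0
      refine hne (huniq q (by simpa using hq) fun i => ?_)
      have := Finset.prod_ne_zero_iff.mp h0 i (Finset.mem_univ i)
      omega
    · intro hnot
      exact absurd (by simpa using hp) hnot
  rw [hcount]
  apply bal_prod k n r hn hr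
  rw [← hw, ← Finset.sum_image (s := Finset.univ) (g := p) (f := w) (fun x _ y _ hxy => hpinj hxy)]
  apply Finset.sum_subset (Finset.subset_univ _)
  intro x _ hx
  by_contra h0
  obtain ⟨i, hi⟩ := hcov x (by omega)
  exact hx (by rw [← hi]; simp)

open Classical in
lemma wcount_le (G : DiGraph) [Fintype G.E] (h : G.V → ℕ)
    (hh : ∀ e, h (G.s e) < h (G.t e)) (k n r : ℕ) (hk : 1 ≤ k) (hn : 1 ≤ n) (hr : r ≤ k)
    (m : ℕ) : ∀ (w : G.E → ℕ), ∑ x, w x = n * k + r →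
    (Finset.univ.filter fun x => 0 < w x).card = m →
    G.wcount k w ≤ (n + 1) ^ r * n ^ (k - r) := by
  induction m using Nat.strong_induction_on with
  | _ m ih =>
    intro w hw hm
    by_cases hall : ∀ e f, e ≠ f → 0 < w e → 0 < w f → ∃ p : Fin k → G.E, G.IsPath p ∧
      (∀ i, 0 < w (p i)) ∧ (∃ i, p i = e) ∧ ∃ i, p i = f
    · exact G.wcount_terminal h hh k n r hk hn hr w hw hall
    · push Not at hall
      obtain ⟨e, f, hef, he, hf, hno⟩ := hall
      have h1 := G.shift_le h hh k w e f (fun p hp hpw hpe ⟨i, hi⟩ => hno p hp hpw hpe i hi)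
      have h2 := ih _ (by rw [← hm]; exact G.shift_supp w e f he hf) (G.shift w e f)
        (by rw [G.shift_sum w e f hef, hw]) rfl
      have h3 := ih _ (by rw [← hm]; exact G.shift_supp w f e hf he) (G.shift w f e)
        (by rw [G.shift_sum w f e hef.symm, hw]) rfl
      refine Nat.le_of_mul_le_mul_left (c := w e + w f) (h1.trans ?_) (by omega)
      rw [add_mul]
      gcongr

end DiGraph

/-- A finite acyclic directed graph with `N ≥ 2` edges, `1 ≤ k ≤ N`,
`N = n·k + r`, `0 ≤ r ≤ k - 1`, has at most `(n+1)^r · n^(k-r)` paths of length `k`. -/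
theorem count_paths_acyclic_le (G : DiGraph) [Finite G.V] [Finite G.E]
    (N n k r : ℕ) (hE : Nat.card G.E = N) (hN : 2 ≤ N)
    (hk1 : 1 ≤ k) (hkN : k ≤ N) (hNkr : N = n * k + r) (hr : r ≤ k - 1)
    (hac : G.Acyclic) :
    Nat.card {p : Fin k → G.E // G.IsPath p} ≤ (n + 1) ^ r * n ^ (k - r) := by
  classical
  have := Fintype.ofFinite G.E
  obtain ⟨h, hh⟩ := G.exists_height hac
  have hn : 1 ≤ n := by
    rcases Nat.eq_zero_or_pos n with h0 | h0
    · subst h0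
      simp at hNkr
      omega
    · exact h0
  have key := G.wcount_le h hh k n r hk1 hn (by omega) _ (fun _ => 1)
    (by rw [← hNkr, ← hE]; simp) rfl
  refine le_trans (le_of_eq ?_) key
  unfold DiGraph.wcount
  rw [Nat.card_eq_fintype_card, Fintype.card_subtype]
  simp
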